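/- Suppose |Y| = 2. Then any SP idealised conformity measure is a refinement of the CP idealised conformity measure and is simultaneously S-optimal, N-optimal, OF-optimal, OE-optimal, U-optimal, M-optimal, F-optimal, E-optimal, OU-optimal and OM-optimal; in particular, for each of the ten criteria S, N, U, M, F, E, OU, OM, OF, OE there exists a refinement of the CP idealised conformity measure that is optimal for that criterion (all ten criteria are BW probabilistic). -/

import Mathlib

noncomputable section Conformal

open Finset

variable {X Y : Type*} [Fintype X] [Fintype Y] [DecidableEq Y]

/-- The p-value `p_A(x,y,τ) = Q{z : A z < A (x,y)} + τ·Q{z : A z = A (x,y)}`. -/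
def pValue (Q A : X × Y → ℝ) (x : X) (y : Y) (τ : ℝ) : ℝ :=
  (∑ z : X × Y, if A z < A (x, y) then Q z else 0)
    + τ * ∑ z : X × Y, if A z = A (x, y) then Q z else 0

/-- The prediction set `Γ_A^ε(x,τ) = {y : p_A(x,y,τ) > ε}`. -/
def predSet (Q A : X × Y → ℝ) (ε : ℝ) (x : X) (τ : ℝ) : Finset Y :=
  Finset.univ.filter fun y => ε < pValue Q A x y τ

/-- The marginal `Q_X` of `Q` on the object space. -/
def margX (Q : X × Y → ℝ) (x : X) : ℝ := ∑ y, Q (x, y)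

/-- The marginal `Q_Y` of `Q` on the label space. -/
def margY (Q : X × Y → ℝ) (y : Y) : ℝ := ∑ x, Q (x, y)

/-- The conditional probability `Q(y|x)`; as a function of `z = (x,y)` this is the
CP idealised conformity measure. -/
def condQ (Q : X × Y → ℝ) (z : X × Y) : ℝ := Q z / margX Q z.1

/-- Expectation `E_{x,τ}` with `x ~ Q_X` and `τ` uniform on `[0,1]`, independent. -/
def expXT (Q : X × Y → ℝ) (g : X → ℝ → ℝ) : ℝ :=
  ∑ x, margX Q x * ∫ τ in (0:ℝ)..1, g x τ

/-- Expectation `E_{(x,y),τ}` with `(x,y) ~ Q` and `τ` uniform on `[0,1]`, independent. -/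
def expZT (Q : X × Y → ℝ) (g : X × Y → ℝ → ℝ) : ℝ :=
  ∑ z, Q z * ∫ τ in (0:ℝ)..1, g z τ

open Classical in
/-- Probability `Prob_{x,τ}` with `x ~ Q_X` and `τ` uniform on `[0,1]`, independent. -/
def probXT (Q : X × Y → ℝ) (P : X → ℝ → Prop) : ℝ :=
  expXT Q fun x τ => if P x τ then 1 else 0

open Classical in
/-- Probability `Prob_{(x,y),τ}` with `(x,y) ~ Q` and `τ` uniform on `[0,1]`, independent. -/
def probZT (Q : X × Y → ℝ) (P : X × Y → ℝ → Prop) : ℝ :=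
  expZT Q fun z τ => if P z τ then 1 else 0

/-- `A` is a refinement of `B`. -/
def Refines (A B : X × Y → ℝ) : Prop :=
  ∀ z1 z2 : X × Y, B z1 < B z2 → A z1 < A z2

/-- `max_{y' ≠ y} p_A(x,y',τ)`. -/
def maxOther (Q A : X × Y → ℝ) (x : X) (y : Y) (τ : ℝ) : ℝ :=
  ⨆ y' : {y' : Y // y' ≠ y}, pValue Q A x y'.1 τ

/-- The unconfidence `min_y max_{y' ≠ y} p_A(x,y',τ)`. -/
def unconf (Q A : X × Y → ℝ) (x : X) (τ : ℝ) : ℝ := ⨅ y : Y, maxOther Q A x y τ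

/-- The credibility `max_y p_A(x,y,τ)`. -/
def maxPV (Q A : X × Y → ℝ) (x : X) (τ : ℝ) : ℝ := ⨆ y : Y, pValue Q A x y τ

/-- The predictability `f(x) = max_y Q(y|x)`. -/
def predictability (Q : X × Y → ℝ) (x : X) : ℝ := ⨆ y : Y, condQ Q (x, y)

/-- `c` is a choice function: `Q(c x | x) = f(x)` for all `x`. -/
def IsChoiceFun (Q : X × Y → ℝ) (c : X → Y) : Prop :=
  ∀ x, condQ Q (x, c x) = predictability Q x

/-- The signed predictability (SP) idealised conformity measure corresponding to `c`. -/
def SPMeasure (Q : X × Y → ℝ) (c : X → Y) : X × Y → ℝ := fun z =>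
  if z.2 = c z.1 then predictability Q z.1 else -predictability Q z.1

/-- The modified conditional probability (MCP) idealised conformity measure
corresponding to `c`. -/
def MCPMeasure (Q : X × Y → ℝ) (c : X → Y) : X × Y → ℝ := fun z =>
  if z.2 = c z.1 then condQ Q z else condQ Q z - 1

/-- The modified signed predictability (MSP) idealised conformity measure
(independent of the choice function: `y = ŷ(x)` iff `Q(y|x) = f(x)` when `f(x) > 1/2`). -/
def MSPMeasure (Q : X × Y → ℝ) : X × Y → ℝ := fun z =>
  if 1 / 2 < predictability Q z.1 then
    if condQ Q z = predictability Q z.1 then predictability Q z.1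
    else -predictability Q z.1
  else 0

/-- S-optimality. -/
def SOpt (Q A : X × Y → ℝ) : Prop :=
  ∀ B : X × Y → ℝ,
    expXT Q (fun x τ => ∑ y, pValue Q A x y τ)
      ≤ expXT Q (fun x τ => ∑ y, pValue Q B x y τ)

/-- N-optimality. -/
def NOpt (Q A : X × Y → ℝ) : Prop :=
  ∀ B : X × Y → ℝ, ∀ ε ∈ Set.Ioo (0:ℝ) 1,
    expXT Q (fun x τ => ((predSet Q A ε x τ).card : ℝ))
      ≤ expXT Q (fun x τ => ((predSet Q B ε x τ).card : ℝ))

/-- OF-optimality. -/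
def OFOpt (Q A : X × Y → ℝ) : Prop :=
  ∀ B : X × Y → ℝ,
    expZT Q (fun z τ => ∑ y' ∈ Finset.univ.erase z.2, pValue Q A z.1 y' τ)
      ≤ expZT Q (fun z τ => ∑ y' ∈ Finset.univ.erase z.2, pValue Q B z.1 y' τ)

/-- OE-optimality. -/
def OEOpt (Q A : X × Y → ℝ) : Prop :=
  ∀ B : X × Y → ℝ, ∀ ε ∈ Set.Ioo (0:ℝ) 1,
    expZT Q (fun z τ => (((predSet Q A ε z.1 τ).erase z.2).card : ℝ))
      ≤ expZT Q (fun z τ => (((predSet Q B ε z.1 τ).erase z.2).card : ℝ))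

/-- U-optimality. -/
def UOpt (Q A : X × Y → ℝ) : Prop :=
  ∀ B : X × Y → ℝ,
    expXT Q (unconf Q A) < expXT Q (unconf Q B) ∨
      (expXT Q (unconf Q A) = expXT Q (unconf Q B) ∧
        expXT Q (maxPV Q A) ≤ expXT Q (maxPV Q B))

/-- M-optimality. -/
def MOpt (Q A : X × Y → ℝ) : Prop :=
  ∀ B : X × Y → ℝ, ∀ ε ∈ Set.Ioo (0:ℝ) 1,
    probXT Q (fun x τ => 1 < (predSet Q A ε x τ).card)
        < probXT Q (fun x τ => 1 < (predSet Q B ε x τ).card) ∨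
      (probXT Q (fun x τ => 1 < (predSet Q A ε x τ).card)
          = probXT Q (fun x τ => 1 < (predSet Q B ε x τ).card) ∧
        probXT Q (fun x τ => (predSet Q B ε x τ).card = 0)
          ≤ probXT Q (fun x τ => (predSet Q A ε x τ).card = 0))

/-- F-optimality. -/
def FOpt (Q A : X × Y → ℝ) : Prop :=
  ∀ B : X × Y → ℝ,
    expXT Q (fun x τ => (∑ y, pValue Q A x y τ) - maxPV Q A x τ)
        < expXT Q (fun x τ => (∑ y, pValue Q B x y τ) - maxPV Q B x τ) ∨
      (expXT Q (fun x τ => (∑ y, pValue Q A x y τ) - maxPV Q A x τ)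
          = expXT Q (fun x τ => (∑ y, pValue Q B x y τ) - maxPV Q B x τ) ∧
        expXT Q (maxPV Q A) ≤ expXT Q (maxPV Q B))

/-- E-optimality. -/
def EOpt (Q A : X × Y → ℝ) : Prop :=
  ∀ B : X × Y → ℝ, ∀ ε ∈ Set.Ioo (0:ℝ) 1,
    expXT Q (fun x τ => max (((predSet Q A ε x τ).card : ℝ) - 1) 0)
        < expXT Q (fun x τ => max (((predSet Q B ε x τ).card : ℝ) - 1) 0) ∨
      (expXT Q (fun x τ => max (((predSet Q A ε x τ).card : ℝ) - 1) 0)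
          = expXT Q (fun x τ => max (((predSet Q B ε x τ).card : ℝ) - 1) 0) ∧
        probXT Q (fun x τ => (predSet Q B ε x τ).card = 0)
          ≤ probXT Q (fun x τ => (predSet Q A ε x τ).card = 0))

/-- OU-optimality. -/
def OUOpt (Q A : X × Y → ℝ) : Prop :=
  ∀ B : X × Y → ℝ,
    expZT Q (fun z τ => maxOther Q A z.1 z.2 τ)
      ≤ expZT Q (fun z τ => maxOther Q B z.1 z.2 τ)

/-- OM-optimality. -/
def OMOpt (Q A : X × Y → ℝ) : Prop :=
  ∀ B : X × Y → ℝ, ∀ ε ∈ Set.Ioo (0:ℝ) 1,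
    probZT Q (fun z τ => ((predSet Q A ε z.1 τ).erase z.2).Nonempty)
      ≤ probZT Q (fun z τ => ((predSet Q B ε z.1 τ).erase z.2).Nonempty)

end Conformal

noncomputable section ConformalOptimality

open Finset intervalIntegral

variable {X Y : Type*} [Fintype X] [Fintype Y] {Q : X × Y → ℝ}

/-- The indicator of `ε < t`. -/
def stepAt (ε t : ℝ) : ℝ := if ε < t then 1 else 0

lemma stepAt_nonneg (ε t : ℝ) : 0 ≤ stepAt ε t := by
  unfold stepAt; split_ifs <;> norm_num

lemma stepAt_le_one (ε t : ℝ) : stepAt ε t ≤ 1 := by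
  unfold stepAt; split_ifs <;> norm_num

lemma monotone_stepAt (ε : ℝ) : Monotone (stepAt ε) := by
  intro s t hst
  unfold stepAt
  split_ifs <;> first | exfalso; linarith | norm_num

lemma antitone_stepAt_left (t : ℝ) : Antitone fun ε => stepAt ε t := by
  intro ε δ hεδ
  simp only [stepAt]
  split_ifs <;> first | exfalso; linarith | norm_num

lemma integral_stepAt_left {t : ℝ} (h0 : 0 ≤ t) (h1 : t ≤ 1) :
    ∫ ε in (0:ℝ)..1, stepAt ε t = t := by
  have hint (a b : ℝ) : IntervalIntegrable (fun ε => stepAt ε t) MeasureTheory.volume a b :=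
    (antitone_stepAt_left t).intervalIntegrable
  have hlow : ∫ ε in (0:ℝ)..t, stepAt ε t = ∫ _ in (0:ℝ)..t, (1 : ℝ) := by
    rw [integral_of_le h0, integral_of_le h0, MeasureTheory.integral_Ioc_eq_integral_Ioo,
      MeasureTheory.integral_Ioc_eq_integral_Ioo]
    exact MeasureTheory.setIntegral_congr_fun measurableSet_Ioo fun ε hε => if_pos hε.2
  have hhigh : ∫ ε in t..1, stepAt ε t = ∫ _ in t..1, (0 : ℝ) :=
    integral_congr fun ε hε => if_neg (by
      rw [Set.uIcc_of_le h1] at hε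
      exact not_lt.2 hε.1)
  rw [← integral_add_adjacent_intervals (hint 0 t) (hint t 1), hlow, hhigh]
  simp

lemma integral_stepAt {ε : ℝ} (h0 : 0 ≤ ε) (h1 : ε ≤ 1) :
    ∫ t in (0:ℝ)..1, stepAt ε t = 1 - ε := by
  have hint (a b : ℝ) : IntervalIntegrable (stepAt ε) MeasureTheory.volume a b :=
    (monotone_stepAt ε).intervalIntegrable
  have hlow : ∫ t in (0:ℝ)..ε, stepAt ε t = ∫ _ in (0:ℝ)..ε, (0 : ℝ) :=
    integral_congr fun t ht => if_neg (by
      rw [Set.uIcc_of_le h0] at ht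
      exact not_lt.2 ht.2)
  have hhigh : ∫ t in ε..1, stepAt ε t = ∫ _ in ε..1, (1 : ℝ) := by
    rw [integral_of_le h1, integral_of_le h1]
    exact MeasureTheory.setIntegral_congr_fun measurableSet_Ioc fun t ht => if_pos ht.1
  rw [← integral_add_adjacent_intervals (hint 0 ε) (hint ε 1), hlow, hhigh]
  simp

/-- Consecutive intervals of lengths `m a`, ordered by `a ∈ S`, tile `[0, ∑ a ∈ S, m a]`. -/
lemma sum_integral_partialSums {g : ℝ → ℝ} (hg : Monotone g) (m : ℝ → ℝ) (S : Finset ℝ) :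
    ∑ a ∈ S, ∫ u in (∑ b ∈ S with b < a, m b)..((∑ b ∈ S with b < a, m b) + m a), g u
      = ∫ u in (0:ℝ)..(∑ a ∈ S, m a), g u := by
  induction S using Finset.induction_on_max with
  | empty => simp
  | insert a S hS ih =>
    have ha : a ∉ S := fun h => lt_irrefl a (hS a h)
    have hself : {b ∈ insert a S | b < a} = S := by
      ext b
      simp only [mem_filter, mem_insert]
      exact ⟨fun h => h.1.resolve_left h.2.ne, fun h => ⟨Or.inr h, hS b h⟩⟩
    have hother : ∀ x ∈ S, {b ∈ insert a S | b < x} = {b ∈ S | b < x} := by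
      intro x hx
      rw [filter_insert, if_neg (hS x hx).not_gt]
    have hsum : ∑ x ∈ S, ∫ u in (∑ b ∈ insert a S with b < x, m b)..
        ((∑ b ∈ insert a S with b < x, m b) + m x), g u = ∫ u in (0:ℝ)..(∑ x ∈ S, m x), g u := by
      rw [← ih]
      exact sum_congr rfl fun x hx => by rw [hother x hx]
    rw [sum_insert ha, sum_insert ha, hself, hsum, add_comm,
      integral_add_adjacent_intervals hg.intervalIntegrable hg.intervalIntegrable,
      add_comm (m a)]

lemma eqMass_nonneg (hQ0 : ∀ z, 0 ≤ Q z) (A : X × Y → ℝ) (a : ℝ) :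
    0 ≤ ∑ z : X × Y, if A z = a then Q z else 0 :=
  sum_nonneg fun z _ => by split_ifs <;> [exact hQ0 z; rfl]

lemma monotone_pValue (hQ0 : ∀ z, 0 ≤ Q z) (A : X × Y → ℝ) (x : X) (y : Y) :
    Monotone (pValue Q A x y) := fun _ _ h =>
  add_le_add_right (mul_le_mul_of_nonneg_right h (eqMass_nonneg hQ0 A _)) _

lemma pValue_zero (A : X × Y → ℝ) (x : X) (y : Y) :
    pValue Q A x y 0 = ∑ z : X × Y, if A z < A (x, y) then Q z else 0 := by
  simp [pValue]

lemma pValue_one (A : X × Y → ℝ) (x : X) (y : Y) :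
    pValue Q A x y 1 = ∑ z : X × Y, if A z ≤ A (x, y) then Q z else 0 := by
  rw [pValue, one_mul, ← sum_add_distrib]
  refine sum_congr rfl fun z _ => ?_
  rcases lt_trichotomy (A z) (A (x, y)) with h | h | h
  · simp [h, h.ne, h.le]
  · simp [h]
  · simp [h.ne', h.not_gt, h.not_ge]

lemma pValue_mem_Icc (hQ0 : ∀ z, 0 ≤ Q z) (hQ1 : ∑ z, Q z = 1) (A : X × Y → ℝ) (x : X) (y : Y)
    {τ : ℝ} (hτ : τ ∈ Set.Icc (0:ℝ) 1) : pValue Q A x y τ ∈ Set.Icc (0:ℝ) 1 := by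
  refine ⟨le_trans ?_ (monotone_pValue hQ0 A x y hτ.1),
    (monotone_pValue hQ0 A x y hτ.2).trans ?_⟩
  · rw [pValue_zero]
    exact sum_nonneg fun z _ => by split_ifs <;> [exact hQ0 z; rfl]
  · rw [pValue_one, ← hQ1]
    exact sum_le_sum fun z _ => by split_ifs <;> [rfl; exact hQ0 z]

lemma pValue_le_pValue_of_lt (hQ0 : ∀ z, 0 ≤ Q z) {A : X × Y → ℝ} {x x' : X} {y y' : Y}
    (h : A (x, y) < A (x', y')) {τ τ' : ℝ} (hτ : τ ≤ 1) (hτ' : 0 ≤ τ') :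
    pValue Q A x y τ ≤ pValue Q A x' y' τ' := by
  refine (monotone_pValue hQ0 A x y hτ).trans (le_trans ?_ (monotone_pValue hQ0 A x' y' hτ'))
  rw [pValue_zero, pValue_one]
  refine sum_le_sum fun z _ => ?_
  by_cases hz : A z ≤ A (x, y)
  · rw [if_pos hz, if_pos (hz.trans_lt h)]
  · rw [if_neg hz]
    split_ifs <;> [exact hQ0 z; rfl]

lemma pValue_le_pValue (hQ0 : ∀ z, 0 ≤ Q z) {A : X × Y → ℝ} {x x' : X} {y y' : Y}
    (h : A (x, y) ≤ A (x', y')) {τ : ℝ} (hτ : τ ∈ Set.Icc (0:ℝ) 1) :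
    pValue Q A x y τ ≤ pValue Q A x' y' τ := by
  rcases h.lt_or_eq with h | h
  · exact pValue_le_pValue_of_lt hQ0 h hτ.2 hτ.1
  · simp [pValue, h]

/-- The mean of `g (p_A(x, y, τ))` over `τ` uniform on `[0, 1]`. -/
def meanP (Q A : X × Y → ℝ) (g : ℝ → ℝ) (x : X) (y : Y) : ℝ :=
  ∫ τ in (0:ℝ)..1, g (pValue Q A x y τ)

lemma intervalIntegrable_comp_pValue (hQ0 : ∀ z, 0 ≤ Q z) (A : X × Y → ℝ) {g : ℝ → ℝ}
    (hg : Monotone g) (x : X) (y : Y) (a b : ℝ) :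
    IntervalIntegrable (fun τ => g (pValue Q A x y τ)) MeasureTheory.volume a b :=
  (hg.comp (monotone_pValue hQ0 A x y)).intervalIntegrable

lemma meanP_congr (A : X × Y → ℝ) {g h : ℝ → ℝ} {x : X} {y : Y}
    (H : ∀ τ ∈ Set.Icc (0:ℝ) 1, g (pValue Q A x y τ) = h τ) :
    meanP Q A g x y = ∫ τ in (0:ℝ)..1, h τ :=
  integral_congr fun τ hτ => H τ (by rwa [Set.uIcc_of_le zero_le_one] at hτ)

/-- Validity: if `(x, y) ~ Q`, the p-value is uniformly distributed on `[0, 1]`. -/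
lemma sum_mul_meanP (hQ1 : ∑ z, Q z = 1) (A : X × Y → ℝ)
    {g : ℝ → ℝ} (hg : Monotone g) :
    ∑ z : X × Y, Q z * meanP Q A g z.1 z.2 = ∫ u in (0:ℝ)..1, g u := by
  classical
  let S : Finset ℝ := univ.image A
  let m : ℝ → ℝ := fun a => ∑ z : X × Y, if A z = a then Q z else 0
  have hmaps : ∀ z ∈ (univ : Finset (X × Y)), A z ∈ S := fun z hz => mem_image_of_mem A hz
  have hlower (a : ℝ) : (∑ z : X × Y, if A z < a then Q z else 0) = ∑ b ∈ S with b < a, m b := by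
    simp only [m]
    rw [sum_comm]
    refine sum_congr rfl fun z _ => ?_
    rw [sum_ite_eq]
    simp [S]
  have htotal : ∑ a ∈ S, m a = 1 := by
    simp only [m]
    rw [sum_comm, ← hQ1]
    refine sum_congr rfl fun z hz => ?_
    rw [sum_ite_eq, if_pos (hmaps z hz)]
  rw [← htotal, ← sum_integral_partialSums hg m S, ← sum_fiberwise_of_maps_to hmaps]
  refine sum_congr rfl fun a _ => ?_
  have hmean : ∀ z ∈ (univ : Finset (X × Y)).filter (fun z => A z = a),
      Q z * meanP Q A g z.1 z.2
        = Q z * ∫ τ in (0:ℝ)..1, g ((∑ b ∈ S with b < a, m b) + m a * τ) := by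
    intro z hz
    rw [mem_filter] at hz
    simp only [meanP, pValue, hz.2, hlower, mul_comm, m]
  rw [sum_congr rfl hmean, ← sum_mul, sum_filter]
  change m a * _ = _
  rw [← smul_eq_mul, smul_integral_comp_add_mul]
  simp

lemma meanP_stepAt_nonneg (A : X × Y → ℝ) (ε : ℝ) (x : X) (y : Y) :
    0 ≤ meanP Q A (stepAt ε) x y :=
  integral_nonneg zero_le_one fun _ _ => stepAt_nonneg _ _

lemma meanP_stepAt_le_one (hQ0 : ∀ z, 0 ≤ Q z) (A : X × Y → ℝ) (ε : ℝ) (x : X) (y : Y) :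
    meanP Q A (stepAt ε) x y ≤ 1 := by
  have h := integral_mono_on zero_le_one
    (intervalIntegrable_comp_pValue hQ0 A (monotone_stepAt ε) x y 0 1)
    (intervalIntegrable_const (c := (1 : ℝ))) fun τ _ => stepAt_le_one ε (pValue Q A x y τ)
  simpa [meanP] using h

lemma meanP_stepAt_of_lt (hQ0 : ∀ z, 0 ≤ Q z) {A : X × Y → ℝ} (ε : ℝ) {x x' : X} {y y' : Y}
    (h : A (x, y) < A (x', y')) :
    meanP Q A (stepAt ε) x y = 0 ∨ meanP Q A (stepAt ε) x' y' = 1 := by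
  by_cases hex : ∃ τ' ∈ Set.Icc (0:ℝ) 1, pValue Q A x' y' τ' ≤ ε
  · obtain ⟨τ', hτ', hle⟩ := hex
    left
    rw [meanP_congr A (h := fun _ => 0) fun τ hτ =>
      if_neg (not_lt.2 ((pValue_le_pValue_of_lt hQ0 h hτ.2 hτ'.1).trans hle))]
    simp
  · push Not at hex
    right
    rw [meanP_congr A (h := fun _ => 1) fun τ hτ => if_pos (hex τ hτ)]
    simp

lemma antitone_meanP_stepAt (hQ0 : ∀ z, 0 ≤ Q z) (A : X × Y → ℝ) (x : X) (y : Y) :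
    Antitone fun ε => meanP Q A (stepAt ε) x y := fun ε δ h =>
  integral_mono_on zero_le_one
    (intervalIntegrable_comp_pValue hQ0 A (monotone_stepAt δ) x y 0 1)
    (intervalIntegrable_comp_pValue hQ0 A (monotone_stepAt ε) x y 0 1)
    fun _ _ => antitone_stepAt_left _ h

/-- The mean p-value is the integral over `ε` of the probability that it exceeds `ε`. -/
lemma meanP_id_eq_integral (hQ0 : ∀ z, 0 ≤ Q z) (hQ1 : ∑ z, Q z = 1) (A : X × Y → ℝ)
    (x : X) (y : Y) :
    meanP Q A id x y = ∫ ε in (0:ℝ)..1, meanP Q A (stepAt ε) x y := by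
  rw [meanP_congr A (h := fun τ => ∫ ε in (0:ℝ)..1, stepAt ε (pValue Q A x y τ)) fun τ hτ =>
    (integral_stepAt_left (pValue_mem_Icc hQ0 hQ1 A x y hτ).1
      (pValue_mem_Icc hQ0 hQ1 A x y hτ).2).symm]
  simp only [meanP, integral_of_le (zero_le_one' ℝ)]
  refine MeasureTheory.integral_integral_swap ?_
  have hmeas : Measurable fun q : ℝ × ℝ => stepAt q.2 (pValue Q A x y q.1) :=
    Measurable.ite (measurableSet_lt measurable_snd (by unfold pValue; fun_prop))
      measurable_const measurable_const
  refine MeasureTheory.Integrable.of_bound hmeas.aestronglyMeasurable 1 ?_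
  filter_upwards with q
  rw [Function.uncurry_def, Real.norm_of_nonneg (stepAt_nonneg _ _)]
  exact stepAt_le_one _ _

/-- Neyman–Pearson lemma on a finite set, for a test `κ` that equals `1` where the ratio `q / w`
is above a threshold and `0` where it is below. -/
lemma sum_mul_le_of_threshold {ι : Type*} [Fintype ι] {w q κ κ' : ι → ℝ} (hw : ∀ i, 0 < w i)
    (hκ1 : ∀ i, κ i ≤ 1) (hκ'0 : ∀ i, 0 ≤ κ' i) (hκ'1 : ∀ i, κ' i ≤ 1)
    (hthr : ∀ i j, q i / w i < q j / w j → κ i = 0 ∨ κ j = 1)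
    (hle : ∑ i, q i * κ i ≤ ∑ i, q i * κ' i) (hex : ∃ i, 0 < q i ∧ κ i < 1) :
    ∑ i, w i * κ i ≤ ∑ i, w i * κ' i := by
  classical
  obtain ⟨i₀, hq₀, hκ₀⟩ := hex
  obtain ⟨j, hj, hmax⟩ := exists_max_image (univ.filter fun i => κ i < 1) (fun i => q i / w i)
    ⟨i₀, by simpa using hκ₀⟩
  replace hj : κ j < 1 := by simpa using hj
  set k := q j / w j with hk
  have hkpos : 0 < k := (div_pos hq₀ (hw i₀)).trans_le (hmax i₀ (by simpa using hκ₀))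
  have hterm : ∀ i, k * (w i * κ i - w i * κ' i) ≤ q i * κ i - q i * κ' i := by
    intro i
    rcases lt_trichotomy (q i / w i) k with h | h | h
    · have hzero : κ i = 0 := (hthr i j h).resolve_right hj.ne
      rw [div_lt_iff₀ (hw i)] at h
      rw [hzero]
      nlinarith [hκ'0 i]
    · rw [div_eq_iff (hw i).ne'] at h
      rw [h]
      exact le_of_eq (by ring)
    · have hone : κ i = 1 := by
        by_contra hne
        exact absurd (hmax i (by simpa using lt_of_le_of_ne (hκ1 i) hne)) (not_le.2 h)
      rw [lt_div_iff₀ (hw i)] at h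
      rw [hone]
      nlinarith [hκ'1 i]
  have hsum := sum_le_sum fun i (_ : i ∈ univ) => hterm i
  rw [← mul_sum, sum_sub_distrib, sum_sub_distrib] at hsum
  nlinarith

/-- The mean of `∑ y, g (p_A(x, y, τ))` over `x ~ Q_X` and `τ` uniform on `[0, 1]`. -/
def totalMean (Q A : X × Y → ℝ) (g : ℝ → ℝ) : ℝ :=
  ∑ z : X × Y, margX Q z.1 * meanP Q A g z.1 z.2

/-- The mean of `g (p_A(x, l x, τ))` over `x ~ Q_X` and `τ` uniform on `[0, 1]`. -/
def selectedMean (Q A : X × Y → ℝ) (g : ℝ → ℝ) (l : X → Y) : ℝ :=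
  ∑ x, margX Q x * meanP Q A g x (l x)

lemma sum_mul_meanP_id_le {ι : Type*} [Fintype ι] (hQ0 : ∀ z, 0 ≤ Q z) (hQ1 : ∑ z, Q z = 1)
    (A B : X × Y → ℝ) (w : ι → ℝ) (x : ι → X) (a b : ι → Y)
    (h : ∀ ε ∈ Set.Ioo (0:ℝ) 1, ∑ i, w i * meanP Q A (stepAt ε) (x i) (a i)
      ≤ ∑ i, w i * meanP Q B (stepAt ε) (x i) (b i)) :
    ∑ i, w i * meanP Q A id (x i) (a i) ≤ ∑ i, w i * meanP Q B id (x i) (b i) := by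
  have hint (C : X × Y → ℝ) (y : ι → Y) (i : ι) : IntervalIntegrable
      (fun ε => w i * meanP Q C (stepAt ε) (x i) (y i)) MeasureTheory.volume 0 1 :=
    (antitone_meanP_stepAt hQ0 C (x i) (y i)).intervalIntegrable.const_mul (w i)
  have heq (C : X × Y → ℝ) (y : ι → Y) : ∑ i, w i * meanP Q C id (x i) (y i)
      = ∫ ε in (0:ℝ)..1, ∑ i, w i * meanP Q C (stepAt ε) (x i) (y i) := by
    rw [integral_finsetSum fun i _ => hint C y i]
    exact sum_congr rfl fun i _ => by
      rw [meanP_id_eq_integral hQ0 hQ1, integral_const_mul]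
  have hsum (C : X × Y → ℝ) (y : ι → Y) : IntervalIntegrable
      (fun ε => ∑ i, w i * meanP Q C (stepAt ε) (x i) (y i)) MeasureTheory.volume 0 1 := by
    simpa only [sum_fn] using IntervalIntegrable.sum univ fun i _ => hint C y i
  rw [heq A a, heq B b]
  exact integral_mono_on_of_le_Ioo zero_le_one (hsum A a) (hsum B b) h

lemma sum_mul_meanP_stepAt (hQ1 : ∑ z, Q z = 1) (A : X × Y → ℝ) {ε : ℝ}
    (hε : ε ∈ Set.Ioo (0:ℝ) 1) :
    ∑ z : X × Y, Q z * meanP Q A (stepAt ε) z.1 z.2 = 1 - ε := by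
  rw [sum_mul_meanP hQ1 A (monotone_stepAt ε), integral_stepAt hε.1.le hε.2.le]

lemma totalMean_stepAt_le (hQ0 : ∀ z, 0 ≤ Q z) (hQ1 : ∑ z, Q z = 1) (hQX : ∀ x, 0 < margX Q x)
    {A : X × Y → ℝ} (hA : Refines A (condQ Q)) (B : X × Y → ℝ) {ε : ℝ}
    (hε : ε ∈ Set.Ioo (0:ℝ) 1) :
    totalMean Q A (stepAt ε) ≤ totalMean Q B (stepAt ε) := by
  refine sum_mul_le_of_threshold (w := fun z : X × Y => margX Q z.1) (q := Q)
    (fun z => hQX z.1) (fun z => meanP_stepAt_le_one hQ0 A ε z.1 z.2)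
    (fun z => meanP_stepAt_nonneg B ε z.1 z.2) (fun z => meanP_stepAt_le_one hQ0 B ε z.1 z.2)
    (fun z z' h => meanP_stepAt_of_lt hQ0 ε (hA z z' h)) ?_ ?_
  · rw [sum_mul_meanP_stepAt hQ1 A hε, sum_mul_meanP_stepAt hQ1 B hε]
  · by_contra! hcon
    have hone : ∀ z : X × Y, Q z * meanP Q A (stepAt ε) z.1 z.2 = Q z := by
      intro z
      rcases (hQ0 z).eq_or_lt with hz | hz
      · rw [← hz, zero_mul]
      · rw [le_antisymm (meanP_stepAt_le_one hQ0 A ε z.1 z.2) (hcon z hz), mul_one]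
    have hvalid := sum_mul_meanP_stepAt hQ1 A hε
    rw [sum_congr rfl fun z _ => hone z, hQ1] at hvalid
    linarith [hε.1]

/-- `σ` sends each label to the unique different label. -/
def IsOtherLabel (σ : Y → Y) : Prop := ∀ y y' : Y, y' ≠ y ↔ y' = σ y

lemma exists_isOtherLabel (hY : Fintype.card Y = 2) : ∃ σ : Y → Y, IsOtherLabel σ := by
  classical
  have h : ∀ y : Y, ∃ y', ∀ w, w ≠ y ↔ w = y' := by
    intro y
    have hcard : (univ.erase y).card = 1 := by
      rw [card_erase_of_mem (mem_univ y), card_univ, hY]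
    obtain ⟨y', hy'⟩ := card_eq_one.1 hcard
    exact ⟨y', fun w => by simpa using congrArg (w ∈ ·) hy'⟩
  choose σ hσ using h
  exact ⟨σ, hσ⟩

section OtherLabel

variable {X Y : Type*} {Q : X × Y → ℝ} {σ : Y → Y}

lemma IsOtherLabel.ne (hσ : IsOtherLabel σ) (y : Y) : σ y ≠ y := (hσ y (σ y)).2 rfl

lemma IsOtherLabel.apply_apply (hσ : IsOtherLabel σ) (y : Y) : σ (σ y) = y :=
  ((hσ (σ y) y).1 (hσ.ne y).symm).symm

lemma IsOtherLabel.eq_or_eq (hσ : IsOtherLabel σ) (y y' : Y) : y' = y ∨ y' = σ y := by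
  rw [← hσ]
  exact eq_or_ne y' y

lemma IsOtherLabel.exists_lower (hσ : IsOtherLabel σ) [Nonempty Y] (B : X × Y → ℝ) :
    ∃ l : X → Y, ∀ x, B (x, l x) ≤ B (x, σ (l x)) := by
  have h : ∀ x, ∃ y, B (x, y) ≤ B (x, σ y) := by
    intro x
    obtain ⟨y⟩ := ‹Nonempty Y›
    rcases le_total (B (x, y)) (B (x, σ y)) with h | h
    · exact ⟨y, h⟩
    · exact ⟨σ y, by rwa [hσ.apply_apply]⟩
  choose l hl using h
  exact ⟨l, hl⟩

variable [Fintype Y]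

lemma IsOtherLabel.sum_eq (hσ : IsOtherLabel σ) {M : Type*} [AddCommMonoid M] (f : Y → M)
    (y : Y) : ∑ y', f y' = f y + f (σ y) := by
  classical
  have huniv : (univ : Finset Y) = {y, σ y} := by
    ext y'
    simpa using hσ.eq_or_eq y y'
  rw [huniv, sum_pair (hσ.ne y).symm]

lemma IsOtherLabel.margX_eq (hσ : IsOtherLabel σ) (x : X) (y : Y) :
    margX Q x = Q (x, y) + Q (x, σ y) := hσ.sum_eq _ y

variable [Fintype X]

lemma IsOtherLabel.sum_prod_eq (hσ : IsOtherLabel σ) (f : X × Y → ℝ) (l : X → Y) :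
    ∑ z, f z = ∑ x, (f (x, l x) + f (x, σ (l x))) := by
  rw [Fintype.sum_prod_type]
  exact sum_congr rfl fun x _ => hσ.sum_eq (fun y => f (x, y)) (l x)

lemma IsOtherLabel.totalMean_eq (hσ : IsOtherLabel σ) (A : X × Y → ℝ) (g : ℝ → ℝ) (l : X → Y) :
    totalMean Q A g = selectedMean Q A g l + selectedMean Q A g (σ ∘ l) := by
  rw [totalMean, hσ.sum_prod_eq _ l, sum_add_distrib]
  rfl

/-- If all less likely labels lie below all more likely ones in a refinement `A` of CP, then `A`
minimises the probability that the smaller of the two p-values exceeds `ε`. -/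
lemma selectedMean_stepAt_le (hσ : IsOtherLabel σ) (hQ0 : ∀ z, 0 ≤ Q z) (hQ1 : ∑ z, Q z = 1)
    (hQX : ∀ x, 0 < margX Q x) {A : X × Y → ℝ} (hA : Refines A (condQ Q)) {c : X → Y}
    (hc : ∀ x, Q (x, σ (c x)) ≤ Q (x, c x)) (hsep : ∀ x x', A (x, σ (c x)) < A (x', c x'))
    (B : X × Y → ℝ) (l : X → Y) {ε : ℝ} (hε : ε ∈ Set.Ioo (0:ℝ) 1) :
    selectedMean Q A (stepAt ε) (σ ∘ c) ≤ selectedMean Q B (stepAt ε) l := by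
  by_cases hzero : ∀ x, meanP Q A (stepAt ε) x (σ (c x)) = 0
  · have hleft : selectedMean Q A (stepAt ε) (σ ∘ c) = 0 :=
      sum_eq_zero fun x _ => by rw [Function.comp_apply, hzero x, mul_zero]
    rw [hleft]
    exact sum_nonneg fun x _ => mul_nonneg (hQX x).le (meanP_stepAt_nonneg B ε x (l x))
  push Not at hzero
  obtain ⟨x₀, hx₀⟩ := hzero
  have htop : ∀ x, meanP Q A (stepAt ε) x (c x) = 1 := fun x =>
    (meanP_stepAt_of_lt hQ0 ε (hsep x₀ x)).resolve_left hx₀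
  have hvalidA : ∑ x, Q (x, c x) + ∑ x, Q (x, σ (c x)) * meanP Q A (stepAt ε) x (σ (c x))
      = 1 - ε := by
    rw [← sum_mul_meanP_stepAt hQ1 A hε, hσ.sum_prod_eq _ c, ← sum_add_distrib]
    exact sum_congr rfl fun x _ => by simp only [htop x, mul_one]
  have hleast : ∀ x y, Q (x, σ (c x)) ≤ Q (x, y) := by
    intro x y
    rcases hσ.eq_or_eq (c x) y with rfl | rfl
    · exact hc x
    · exact le_rfl
  refine sum_mul_le_of_threshold (w := margX Q) (q := fun x => Q (x, σ (c x))) hQX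
    (fun x => meanP_stepAt_le_one hQ0 A ε x _) (fun x => meanP_stepAt_nonneg B ε x _)
    (fun x => meanP_stepAt_le_one hQ0 B ε x _)
    (fun x x' h => meanP_stepAt_of_lt hQ0 ε (hA (x, σ (c x)) (x', σ (c x')) h)) ?_ ?_
  · have hvalidB : 1 - ε ≤ ∑ x, Q (x, c x)
        + ∑ x, Q (x, σ (c x)) * meanP Q B (stepAt ε) x (l x) := by
      rw [← sum_mul_meanP_stepAt hQ1 B hε, hσ.sum_prod_eq _ l, ← sum_add_distrib]
      refine sum_le_sum fun x _ => ?_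
      have hmarg : Q (x, c x) + Q (x, σ (c x)) = Q (x, l x) + Q (x, σ (l x)) := by
        rw [← hσ.margX_eq, ← hσ.margX_eq]
      have hlow := mul_nonneg (sub_nonneg.2 (hleast x (l x)))
        (sub_nonneg.2 (meanP_stepAt_le_one hQ0 B ε x (l x)))
      have hup := mul_nonneg (hQ0 (x, σ (l x)))
        (sub_nonneg.2 (meanP_stepAt_le_one hQ0 B ε x (σ (l x))))
      dsimp only
      nlinarith
    simp only [Function.comp_apply]
    linarith
  · by_contra! hcon
    simp only [Function.comp_apply] at hcon
    have hone : ∀ x, Q (x, σ (c x)) * meanP Q A (stepAt ε) x (σ (c x)) = Q (x, σ (c x)) := by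
      intro x
      rcases (hQ0 (x, σ (c x))).eq_or_lt with hx | hx
      · rw [← hx, zero_mul]
      · rw [le_antisymm (meanP_stepAt_le_one hQ0 A ε x _) (hcon x hx), mul_one]
    rw [sum_congr rfl fun x _ => hone x, ← sum_add_distrib, ← hσ.sum_prod_eq, hQ1] at hvalidA
    linarith [hε.1]

lemma expXT_congr {f g : X → ℝ → ℝ} (h : ∀ x, ∀ τ ∈ Set.Icc (0:ℝ) 1, f x τ = g x τ) :
    expXT Q f = expXT Q g :=
  sum_congr rfl fun x _ => congrArg _ <| integral_congr fun τ hτ =>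
    h x τ (by rwa [Set.uIcc_of_le zero_le_one] at hτ)

lemma expXT_sum_comp_pValue (hQ0 : ∀ z, 0 ≤ Q z) (A : X × Y → ℝ) {g : ℝ → ℝ}
    (hg : Monotone g) : expXT Q (fun x τ => ∑ y, g (pValue Q A x y τ)) = totalMean Q A g := by
  rw [totalMean, Fintype.sum_prod_type, expXT]
  refine sum_congr rfl fun x _ => ?_
  rw [integral_finsetSum fun y _ => intervalIntegrable_comp_pValue hQ0 A hg x y 0 1, mul_sum]
  rfl

lemma expXT_one_sub_comp_pValue (hQ0 : ∀ z, 0 ≤ Q z) (A : X × Y → ℝ) {g : ℝ → ℝ}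
    (hg : Monotone g) (l : X → Y) :
    expXT Q (fun x τ => 1 - g (pValue Q A x (l x) τ))
      = ∑ x, margX Q x - selectedMean Q A g l := by
  rw [expXT, selectedMean, ← sum_sub_distrib]
  refine sum_congr rfl fun x _ => ?_
  rw [integral_sub intervalIntegrable_const
    (intervalIntegrable_comp_pValue hQ0 A hg x (l x) 0 1), meanP]
  simp only [integral_const, sub_zero, smul_eq_mul, mul_one]
  ring

lemma IsOtherLabel.expZT_comp_pValue (hσ : IsOtherLabel σ) (hQ1 : ∑ z, Q z = 1)
    (A : X × Y → ℝ) {g : ℝ → ℝ} (hg : Monotone g) :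
    expZT Q (fun z τ => g (pValue Q A z.1 (σ z.2) τ))
      = totalMean Q A g - ∫ u in (0:ℝ)..1, g u := by
  rw [← sum_mul_meanP hQ1 A hg, totalMean, ← sum_sub_distrib, expZT, Fintype.sum_prod_type,
    Fintype.sum_prod_type]
  refine sum_congr rfl fun x _ => ?_
  refine Fintype.sum_bijective σ (Function.Involutive.bijective hσ.apply_apply) _ _ fun y => ?_
  rw [hσ.margX_eq x y, meanP]
  ring

lemma IsOtherLabel.maxOther_eq (hσ : IsOtherLabel σ) (A : X × Y → ℝ) (x : X) (y : Y) (τ : ℝ) :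
    maxOther Q A x y τ = pValue Q A x (σ y) τ := by
  have : Nonempty {y' : Y // y' ≠ y} := ⟨⟨σ y, hσ.ne y⟩⟩
  exact (iSup_congr fun y' => by rw [(hσ y y').1 y'.2]).trans ciSup_const

section Lower

variable {B : X × Y → ℝ} {l : X → Y}

lemma IsOtherLabel.maxPV_eq (hσ : IsOtherLabel σ) (hQ0 : ∀ z, 0 ≤ Q z)
    (hl : ∀ x, B (x, l x) ≤ B (x, σ (l x))) (x : X) {τ : ℝ} (hτ : τ ∈ Set.Icc (0:ℝ) 1) :
    maxPV Q B x τ = pValue Q B x (σ (l x)) τ := by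
  have : Nonempty Y := ⟨l x⟩
  refine le_antisymm (ciSup_le fun y => ?_)
    (le_ciSup (f := fun y => pValue Q B x y τ) (Set.finite_range _).bddAbove _)
  rcases hσ.eq_or_eq (l x) y with rfl | rfl
  · exact pValue_le_pValue hQ0 (hl x) hτ
  · exact le_rfl

lemma IsOtherLabel.unconf_eq (hσ : IsOtherLabel σ) (hQ0 : ∀ z, 0 ≤ Q z)
    (hl : ∀ x, B (x, l x) ≤ B (x, σ (l x))) (x : X) {τ : ℝ} (hτ : τ ∈ Set.Icc (0:ℝ) 1) :
    unconf Q B x τ = pValue Q B x (l x) τ := by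
  have : Nonempty Y := ⟨l x⟩
  simp only [unconf, hσ.maxOther_eq]
  refine le_antisymm ?_ (le_ciInf fun y => ?_)
  · refine (ciInf_le (Set.finite_range _).bddBelow (σ (l x))).trans_eq ?_
    rw [hσ.apply_apply]
  · rcases hσ.eq_or_eq (l x) (σ y) with h | h <;> rw [h]
    exact pValue_le_pValue hQ0 (hl x) hτ

lemma IsOtherLabel.sum_sub_maxPV_eq (hσ : IsOtherLabel σ) (hQ0 : ∀ z, 0 ≤ Q z)
    (hl : ∀ x, B (x, l x) ≤ B (x, σ (l x))) (x : X) {τ : ℝ} (hτ : τ ∈ Set.Icc (0:ℝ) 1) :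
    (∑ y, pValue Q B x y τ) - maxPV Q B x τ = pValue Q B x (l x) τ := by
  rw [hσ.maxPV_eq hQ0 hl x hτ, hσ.sum_eq _ (l x), add_sub_cancel_right]

lemma card_predSet (A : X × Y → ℝ) (ε : ℝ) (x : X) (τ : ℝ) :
    ((predSet Q A ε x τ).card : ℝ) = ∑ y, stepAt ε (pValue Q A x y τ) := by
  simp [predSet, stepAt]

lemma IsOtherLabel.one_lt_card_predSet_iff (hσ : IsOtherLabel σ) (hQ0 : ∀ z, 0 ≤ Q z)
    (hl : ∀ x, B (x, l x) ≤ B (x, σ (l x))) (ε : ℝ) (x : X) {τ : ℝ}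
    (hτ : τ ∈ Set.Icc (0:ℝ) 1) :
    1 < (predSet Q B ε x τ).card ↔ ε < pValue Q B x (l x) τ := by
  have hle := pValue_le_pValue hQ0 (hl x) hτ
  rw [predSet, card_filter, hσ.sum_eq _ (l x)]
  split_ifs with h₁ h₂ h₂ <;> simp [h₁]
  exact h₂ (h₁.trans_le hle)

lemma IsOtherLabel.card_predSet_eq_zero_iff (hσ : IsOtherLabel σ) (hQ0 : ∀ z, 0 ≤ Q z)
    (hl : ∀ x, B (x, l x) ≤ B (x, σ (l x))) (ε : ℝ) (x : X) {τ : ℝ}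
    (hτ : τ ∈ Set.Icc (0:ℝ) 1) :
    (predSet Q B ε x τ).card = 0 ↔ ¬ ε < pValue Q B x (σ (l x)) τ := by
  have hle := pValue_le_pValue hQ0 (hl x) hτ
  rw [predSet, card_filter, hσ.sum_eq _ (l x)]
  split_ifs with h₁ h₂ h₂ <;> simp [h₂]
  exact h₂ (h₁.trans_le hle)

lemma IsOtherLabel.max_card_predSet_sub_one (hσ : IsOtherLabel σ) (hQ0 : ∀ z, 0 ≤ Q z)
    (hl : ∀ x, B (x, l x) ≤ B (x, σ (l x))) (ε : ℝ) (x : X) {τ : ℝ}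
    (hτ : τ ∈ Set.Icc (0:ℝ) 1) :
    max (((predSet Q B ε x τ).card : ℝ) - 1) 0 = stepAt ε (pValue Q B x (l x) τ) := by
  have hle := monotone_stepAt ε (pValue_le_pValue hQ0 (hl x) hτ)
  rw [card_predSet, hσ.sum_eq _ (l x)]
  revert hle
  unfold stepAt
  split_ifs <;> norm_num

lemma IsOtherLabel.expXT_unconf (hσ : IsOtherLabel σ) (hQ0 : ∀ z, 0 ≤ Q z)
    (hl : ∀ x, B (x, l x) ≤ B (x, σ (l x))) :
    expXT Q (unconf Q B) = selectedMean Q B id l :=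
  expXT_congr fun x _ hτ => hσ.unconf_eq hQ0 hl x hτ

lemma IsOtherLabel.expXT_sum_sub_maxPV (hσ : IsOtherLabel σ) (hQ0 : ∀ z, 0 ≤ Q z)
    (hl : ∀ x, B (x, l x) ≤ B (x, σ (l x))) :
    expXT Q (fun x τ => (∑ y, pValue Q B x y τ) - maxPV Q B x τ) = selectedMean Q B id l :=
  expXT_congr fun x _ hτ => hσ.sum_sub_maxPV_eq hQ0 hl x hτ

lemma IsOtherLabel.expXT_maxPV (hσ : IsOtherLabel σ) (hQ0 : ∀ z, 0 ≤ Q z)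
    (hl : ∀ x, B (x, l x) ≤ B (x, σ (l x))) :
    expXT Q (maxPV Q B) = selectedMean Q B id (σ ∘ l) :=
  expXT_congr fun x _ hτ => hσ.maxPV_eq hQ0 hl x hτ

lemma IsOtherLabel.expXT_max_card_predSet (hσ : IsOtherLabel σ) (hQ0 : ∀ z, 0 ≤ Q z)
    (hl : ∀ x, B (x, l x) ≤ B (x, σ (l x))) (ε : ℝ) :
    expXT Q (fun x τ => max (((predSet Q B ε x τ).card : ℝ) - 1) 0)
      = selectedMean Q B (stepAt ε) l :=
  expXT_congr fun x _ hτ => hσ.max_card_predSet_sub_one hQ0 hl ε x hτ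

lemma IsOtherLabel.probXT_one_lt_card_predSet (hσ : IsOtherLabel σ) (hQ0 : ∀ z, 0 ≤ Q z)
    (hl : ∀ x, B (x, l x) ≤ B (x, σ (l x))) (ε : ℝ) :
    probXT Q (fun x τ => 1 < (predSet Q B ε x τ).card) = selectedMean Q B (stepAt ε) l :=
  expXT_congr fun x _ hτ => by simp only [hσ.one_lt_card_predSet_iff hQ0 hl ε x hτ, stepAt]

lemma IsOtherLabel.probXT_card_predSet_eq_zero (hσ : IsOtherLabel σ) (hQ0 : ∀ z, 0 ≤ Q z)
    (hl : ∀ x, B (x, l x) ≤ B (x, σ (l x))) (ε : ℝ) :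
    probXT Q (fun x τ => (predSet Q B ε x τ).card = 0)
      = ∑ x, margX Q x - selectedMean Q B (stepAt ε) (σ ∘ l) := by
  rw [← expXT_one_sub_comp_pValue hQ0 B (monotone_stepAt ε)]
  refine expXT_congr fun x τ hτ => ?_
  simp only [hσ.card_predSet_eq_zero_iff hQ0 hl ε x hτ, stepAt, Function.comp_apply]
  split_ifs <;> norm_num

end Lower

section Observed

variable [DecidableEq Y]

lemma IsOtherLabel.expZT_sum_erase (hσ : IsOtherLabel σ) (hQ1 : ∑ z, Q z = 1)
    (A : X × Y → ℝ) {g : ℝ → ℝ} (hg : Monotone g) :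
    expZT Q (fun z τ => ∑ y' ∈ univ.erase z.2, g (pValue Q A z.1 y' τ))
      = totalMean Q A g - ∫ u in (0:ℝ)..1, g u := by
  have herase (y : Y) : univ.erase y = {σ y} := by
    ext y'
    simpa using hσ y y'
  simp only [herase, sum_singleton]
  exact hσ.expZT_comp_pValue hQ1 A hg

lemma card_erase_predSet (A : X × Y → ℝ) (ε : ℝ) (x : X) (y : Y) (τ : ℝ) :
    (((predSet Q A ε x τ).erase y).card : ℝ)
      = ∑ y' ∈ univ.erase y, stepAt ε (pValue Q A x y' τ) := by
  simp [predSet, stepAt, ← filter_erase]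

lemma IsOtherLabel.erase_predSet_nonempty_iff (hσ : IsOtherLabel σ) (A : X × Y → ℝ) (ε : ℝ)
    (x : X) (y : Y) (τ : ℝ) :
    ((predSet Q A ε x τ).erase y).Nonempty ↔ ε < pValue Q A x (σ y) τ := by
  simp [Finset.Nonempty, predSet, hσ y]

end Observed

end OtherLabel

lemma IsChoiceFun.le {X : Type*} {Q : X × Y → ℝ} {c : X → Y} (hc : IsChoiceFun Q c) (x : X) (y : Y) :
    condQ Q (x, y) ≤ condQ Q (x, c x) := by
  rw [hc x]
  exact le_ciSup (f := fun y => condQ Q (x, y)) (Set.finite_range _).bddAbove y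

lemma IsOtherLabel.condQ_add_condQ {X Y : Type*} [Fintype Y] {Q : X × Y → ℝ} {σ : Y → Y}
    (hσ : IsOtherLabel σ) {x : X} (hx : margX Q x ≠ 0) (y : Y) :
    condQ Q (x, y) + condQ Q (x, σ y) = 1 := by
  simp only [condQ]
  rw [← add_div, ← hσ.margX_eq, div_self hx]

section SignedPredictability

variable {X Y : Type*} [Fintype Y] {Q : X × Y → ℝ} {σ : Y → Y} {c : X → Y}

lemma half_le_condQ_choice (hσ : IsOtherLabel σ) (hQX : ∀ x, 0 < margX Q x)
    (hc : IsChoiceFun Q c) (x : X) : 1 / 2 ≤ condQ Q (x, c x) := by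
  linarith [hσ.condQ_add_condQ (hQX x).ne' (c x), hc.le x (σ (c x))]

variable [DecidableEq Y]

lemma SPMeasure_choice (hc : IsChoiceFun Q c) (x : X) :
    SPMeasure Q c (x, c x) = condQ Q (x, c x) := by
  simp [SPMeasure, hc x]

lemma SPMeasure_other (hσ : IsOtherLabel σ) (hQX : ∀ x, 0 < margX Q x) (hc : IsChoiceFun Q c)
    (x : X) : SPMeasure Q c (x, σ (c x)) = condQ Q (x, σ (c x)) - 1 := by
  have hadd := hσ.condQ_add_condQ (hQX x).ne' (c x)
  simp only [SPMeasure, hσ.ne, if_false, ← hc x]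
  linarith

lemma SPMeasure_other_lt_choice (hσ : IsOtherLabel σ) (hQX : ∀ x, 0 < margX Q x)
    (hc : IsChoiceFun Q c) (x x' : X) :
    SPMeasure Q c (x, σ (c x)) < SPMeasure Q c (x', c x') := by
  rw [SPMeasure_other hσ hQX hc, SPMeasure_choice hc]
  linarith [hσ.condQ_add_condQ (hQX x).ne' (c x), half_le_condQ_choice hσ hQX hc x,
    half_le_condQ_choice hσ hQX hc x']

lemma refines_SPMeasure (hσ : IsOtherLabel σ) (hQX : ∀ x, 0 < margX Q x)
    (hc : IsChoiceFun Q c) : Refines (SPMeasure Q c) (condQ Q) := by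
  rintro ⟨x, y⟩ ⟨x', y'⟩ h
  rcases hσ.eq_or_eq (c x) y with rfl | rfl <;> rcases hσ.eq_or_eq (c x') y' with rfl | rfl
  · rwa [SPMeasure_choice hc, SPMeasure_choice hc]
  · linarith [hσ.condQ_add_condQ (hQX x').ne' (c x'), half_le_condQ_choice hσ hQX hc x,
      half_le_condQ_choice hσ hQX hc x']
  · exact SPMeasure_other_lt_choice hσ hQX hc x x'
  · rw [SPMeasure_other hσ hQX hc, SPMeasure_other hσ hQX hc]
    linarith

end SignedPredictability

/-- Lexicographic comparison of `(a, b)` with `(a', b')` from comparisons of `a` and `a + b`. -/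
lemma lt_or_eq_and_le_of_add_le {a b a' b' : ℝ} (ha : a ≤ a') (hab : a + b ≤ a' + b') :
    a < a' ∨ a = a' ∧ b ≤ b' := by
  rcases ha.lt_or_eq with h | h
  · exact Or.inl h
  · exact Or.inr ⟨h, by linarith⟩

section Optimality

variable {A : X × Y → ℝ} {σ : Y → Y}

lemma SOpt_of_totalMean_le (hQ0 : ∀ z, 0 ≤ Q z)
    (hT : ∀ B, totalMean Q A id ≤ totalMean Q B id) : SOpt Q A := by
  intro B
  have h := hT B
  rw [← expXT_sum_comp_pValue hQ0 A monotone_id, ← expXT_sum_comp_pValue hQ0 B monotone_id] at h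
  exact h

lemma NOpt_of_totalMean_le (hQ0 : ∀ z, 0 ≤ Q z)
    (hT : ∀ B, ∀ ε ∈ Set.Ioo (0:ℝ) 1, totalMean Q A (stepAt ε) ≤ totalMean Q B (stepAt ε)) :
    NOpt Q A := by
  intro B ε hε
  simp only [card_predSet, expXT_sum_comp_pValue hQ0 _ (monotone_stepAt ε)]
  exact hT B ε hε

lemma OUOpt_of_totalMean_le (hσ : IsOtherLabel σ) (hQ1 : ∑ z, Q z = 1)
    (hT : ∀ B, totalMean Q A id ≤ totalMean Q B id) : OUOpt Q A := by
  intro B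
  have h := sub_le_sub_right (hT B) (∫ u in (0:ℝ)..1, id u)
  rw [← hσ.expZT_comp_pValue hQ1 A monotone_id, ← hσ.expZT_comp_pValue hQ1 B monotone_id] at h
  simpa only [hσ.maxOther_eq, id_eq] using h

lemma OMOpt_of_totalMean_le [DecidableEq Y] (hσ : IsOtherLabel σ) (hQ1 : ∑ z, Q z = 1)
    (hT : ∀ B, ∀ ε ∈ Set.Ioo (0:ℝ) 1, totalMean Q A (stepAt ε) ≤ totalMean Q B (stepAt ε)) :
    OMOpt Q A := by
  have hprob (B : X × Y → ℝ) (ε : ℝ) :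
      probZT Q (fun z τ => ((predSet Q B ε z.1 τ).erase z.2).Nonempty)
        = totalMean Q B (stepAt ε) - ∫ u in (0:ℝ)..1, stepAt ε u := by
    rw [← hσ.expZT_comp_pValue hQ1 B (monotone_stepAt ε)]
    simp only [probZT, hσ.erase_predSet_nonempty_iff, stepAt]
  intro B ε hε
  rw [hprob, hprob]
  exact sub_le_sub_right (hT B ε hε) _

lemma OFOpt_of_totalMean_le [DecidableEq Y] (hσ : IsOtherLabel σ) (hQ1 : ∑ z, Q z = 1)
    (hT : ∀ B, totalMean Q A id ≤ totalMean Q B id) : OFOpt Q A := by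
  intro B
  have h := sub_le_sub_right (hT B) (∫ u in (0:ℝ)..1, id u)
  rw [← hσ.expZT_sum_erase hQ1 A monotone_id, ← hσ.expZT_sum_erase hQ1 B monotone_id] at h
  exact h

lemma OEOpt_of_totalMean_le [DecidableEq Y] (hσ : IsOtherLabel σ) (hQ1 : ∑ z, Q z = 1)
    (hT : ∀ B, ∀ ε ∈ Set.Ioo (0:ℝ) 1, totalMean Q A (stepAt ε) ≤ totalMean Q B (stepAt ε)) :
    OEOpt Q A := by
  intro B ε hε
  simp only [card_erase_predSet, hσ.expZT_sum_erase hQ1 _ (monotone_stepAt ε)]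
  exact sub_le_sub_right (hT B ε hε) _

variable {l : X → Y}

lemma UOpt_and_FOpt_of_selectedMean_le [Nonempty Y] (hσ : IsOtherLabel σ) (hQ0 : ∀ z, 0 ≤ Q z)
    (hl : ∀ x, A (x, l x) ≤ A (x, σ (l x)))
    (hT : ∀ B, totalMean Q A id ≤ totalMean Q B id)
    (hL : ∀ B l', selectedMean Q A id l ≤ selectedMean Q B id l') : UOpt Q A ∧ FOpt Q A := by
  have hlex (B : X × Y → ℝ) (l' : X → Y) := lt_or_eq_and_le_of_add_le (hL B l')
    ((hσ.totalMean_eq A id l).symm.trans_le ((hT B).trans_eq (hσ.totalMean_eq B id l')))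
  constructor <;> intro B <;> obtain ⟨l', hl'⟩ := hσ.exists_lower B
  · rw [hσ.expXT_unconf hQ0 hl, hσ.expXT_unconf hQ0 hl', hσ.expXT_maxPV hQ0 hl,
      hσ.expXT_maxPV hQ0 hl']
    exact hlex B l'
  · rw [hσ.expXT_sum_sub_maxPV hQ0 hl, hσ.expXT_sum_sub_maxPV hQ0 hl', hσ.expXT_maxPV hQ0 hl,
      hσ.expXT_maxPV hQ0 hl']
    exact hlex B l'

lemma MOpt_and_EOpt_of_selectedMean_le [Nonempty Y] (hσ : IsOtherLabel σ) (hQ0 : ∀ z, 0 ≤ Q z)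
    (hl : ∀ x, A (x, l x) ≤ A (x, σ (l x)))
    (hT : ∀ B, ∀ ε ∈ Set.Ioo (0:ℝ) 1, totalMean Q A (stepAt ε) ≤ totalMean Q B (stepAt ε))
    (hL : ∀ B l', ∀ ε ∈ Set.Ioo (0:ℝ) 1,
      selectedMean Q A (stepAt ε) l ≤ selectedMean Q B (stepAt ε) l') : MOpt Q A ∧ EOpt Q A := by
  have hlex (B : X × Y → ℝ) (l' : X → Y) (ε : ℝ) (hε : ε ∈ Set.Ioo (0:ℝ) 1) :=
    lt_or_eq_and_le_of_add_le (hL B l' ε hε) ((hσ.totalMean_eq A _ l).symm.trans_le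
      ((hT B ε hε).trans_eq (hσ.totalMean_eq B _ l')))
  constructor <;> intro B ε hε <;> obtain ⟨l', hl'⟩ := hσ.exists_lower B
  · rw [hσ.probXT_one_lt_card_predSet hQ0 hl, hσ.probXT_one_lt_card_predSet hQ0 hl',
      hσ.probXT_card_predSet_eq_zero hQ0 hl, hσ.probXT_card_predSet_eq_zero hQ0 hl',
      sub_le_sub_iff_left]
    exact hlex B l' ε hε
  · rw [hσ.expXT_max_card_predSet hQ0 hl, hσ.expXT_max_card_predSet hQ0 hl',
      hσ.probXT_card_predSet_eq_zero hQ0 hl, hσ.probXT_card_predSet_eq_zero hQ0 hl',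
      sub_le_sub_iff_left]
    exact hlex B l' ε hε

end Optimality

/-- The SP measure refines CP and is optimal for all ten criteria. -/
lemma SPMeasure_optimal [DecidableEq Y] (hY : Fintype.card Y = 2) (hQ0 : ∀ z, 0 ≤ Q z)
    (hQ1 : ∑ z : X × Y, Q z = 1) (hQX : ∀ x, 0 < margX Q x) {c : X → Y}
    (hc : IsChoiceFun Q c) :
    Refines (SPMeasure Q c) (condQ Q) ∧
      SOpt Q (SPMeasure Q c) ∧ NOpt Q (SPMeasure Q c) ∧ OFOpt Q (SPMeasure Q c) ∧
      OEOpt Q (SPMeasure Q c) ∧ UOpt Q (SPMeasure Q c) ∧ MOpt Q (SPMeasure Q c) ∧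
      FOpt Q (SPMeasure Q c) ∧ EOpt Q (SPMeasure Q c) ∧ OUOpt Q (SPMeasure Q c) ∧
      OMOpt Q (SPMeasure Q c) := by
  have : Nonempty Y := Fintype.card_pos_iff.1 (by omega)
  obtain ⟨σ, hσ⟩ := exists_isOtherLabel hY
  have hR := refines_SPMeasure hσ hQX hc
  have hsep := SPMeasure_other_lt_choice hσ hQX hc
  have hle : ∀ x, Q (x, σ (c x)) ≤ Q (x, c x) := fun x =>
    (div_le_div_iff_of_pos_right (hQX x)).1 (hc.le x (σ (c x)))
  have hl : ∀ x, SPMeasure Q c (x, (σ ∘ c) x) ≤ SPMeasure Q c (x, σ ((σ ∘ c) x)) := by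
    intro x
    rw [Function.comp_apply, hσ.apply_apply]
    exact (hsep x x).le
  have hTstep : ∀ B, ∀ ε ∈ Set.Ioo (0:ℝ) 1,
      totalMean Q (SPMeasure Q c) (stepAt ε) ≤ totalMean Q B (stepAt ε) := fun B ε hε =>
    totalMean_stepAt_le hQ0 hQ1 hQX hR B hε
  have hLstep : ∀ B l', ∀ ε ∈ Set.Ioo (0:ℝ) 1,
      selectedMean Q (SPMeasure Q c) (stepAt ε) (σ ∘ c) ≤ selectedMean Q B (stepAt ε) l' :=
    fun B l' ε hε => selectedMean_stepAt_le hσ hQ0 hQ1 hQX hR hle hsep B l' hε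
  have hT : ∀ B, totalMean Q (SPMeasure Q c) id ≤ totalMean Q B id := fun B =>
    sum_mul_meanP_id_le hQ0 hQ1 _ B (fun z : X × Y => margX Q z.1) Prod.fst Prod.snd Prod.snd
      (hTstep B)
  have hL : ∀ B l', selectedMean Q (SPMeasure Q c) id (σ ∘ c) ≤ selectedMean Q B id l' :=
    fun B l' => sum_mul_meanP_id_le hQ0 hQ1 _ B (margX Q) id (σ ∘ c) l' (hLstep B l')
  have hUF := UOpt_and_FOpt_of_selectedMean_le hσ hQ0 hl hT hL
  have hME := MOpt_and_EOpt_of_selectedMean_le hσ hQ0 hl hTstep hLstep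
  exact ⟨hR, SOpt_of_totalMean_le hQ0 hT, NOpt_of_totalMean_le hQ0 hTstep,
    OFOpt_of_totalMean_le hσ hQ1 hT, OEOpt_of_totalMean_le hσ hQ1 hTstep, hUF.1, hME.1, hUF.2,
    hME.2, OUOpt_of_totalMean_le hσ hQ1 hT, OMOpt_of_totalMean_le hσ hQ1 hTstep⟩

lemma exists_isChoiceFun {X Y : Type*} [Fintype Y] [Nonempty Y] (Q : X × Y → ℝ) :
    ∃ c : X → Y, IsChoiceFun Q c := by
  choose c hc using fun x => exists_eq_ciSup_of_finite (f := fun y : Y => condQ Q (x, y))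
  exact ⟨c, hc⟩

end ConformalOptimality

/-- If `|Y| = 2`, any SP idealised conformity measure refines the CP measure and is
optimal for all ten criteria; in particular each of the ten criteria admits an optimal
refinement of CP (all ten criteria are BW probabilistic). -/
theorem stmt4 {X Y : Type*} [Fintype X] [Fintype Y] [DecidableEq Y] [Nonempty X]
    (hY : Fintype.card Y = 2) (Q : X × Y → ℝ) (hQ0 : ∀ z, 0 ≤ Q z)
    (hQ1 : ∑ z : X × Y, Q z = 1) (hQX : ∀ x, 0 < margX Q x) :
    (∀ c : X → Y, IsChoiceFun Q c →
      Refines (SPMeasure Q c) (condQ Q) ∧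
        SOpt Q (SPMeasure Q c) ∧ NOpt Q (SPMeasure Q c) ∧ OFOpt Q (SPMeasure Q c) ∧
        OEOpt Q (SPMeasure Q c) ∧ UOpt Q (SPMeasure Q c) ∧ MOpt Q (SPMeasure Q c) ∧
        FOpt Q (SPMeasure Q c) ∧ EOpt Q (SPMeasure Q c) ∧ OUOpt Q (SPMeasure Q c) ∧
        OMOpt Q (SPMeasure Q c)) ∧
    (∃ A, Refines A (condQ Q) ∧ SOpt Q A) ∧ (∃ A, Refines A (condQ Q) ∧ NOpt Q A) ∧
    (∃ A, Refines A (condQ Q) ∧ UOpt Q A) ∧ (∃ A, Refines A (condQ Q) ∧ MOpt Q A) ∧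
    (∃ A, Refines A (condQ Q) ∧ FOpt Q A) ∧ (∃ A, Refines A (condQ Q) ∧ EOpt Q A) ∧
    (∃ A, Refines A (condQ Q) ∧ OUOpt Q A) ∧ (∃ A, Refines A (condQ Q) ∧ OMOpt Q A) ∧
    (∃ A, Refines A (condQ Q) ∧ OFOpt Q A) ∧ (∃ A, Refines A (condQ Q) ∧ OEOpt Q A) := by
  have hSP := fun c (hc : IsChoiceFun Q c) => SPMeasure_optimal hY hQ0 hQ1 hQX hc
  have : Nonempty Y := Fintype.card_pos_iff.1 (by omega)
  obtain ⟨c, hc⟩ := exists_isChoiceFun Q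
  obtain ⟨hR, hS, hN, hOF, hOE, hU, hM, hF, hE, hOU, hOM⟩ := hSP c hc
  exact ⟨hSP, ⟨_, hR, hS⟩, ⟨_, hR, hN⟩, ⟨_, hR, hU⟩, ⟨_, hR, hM⟩, ⟨_, hR, hF⟩, ⟨_, hR, hE⟩,
    ⟨_, hR, hOU⟩, ⟨_, hR, hOM⟩, ⟨_, hR, hOF⟩, ⟨_, hR, hOE⟩⟩
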